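/- For every positive integer r, every integer n ≥ 2, and every color i ∈ {0,…,r−1}, in ℤ[q] one has ∑_{σ ∈ R^i_{r,n}} q^{exc^Abs(σ)} (−1)^{cyc(σ)} = q^{i+1} · ∑_{σ ∈ G_{r,n−1}} q^{exc^Abs(σ)} (−1)^{cyc(σ)}, where R^i_{r,n} = {σ = (z,τ) ∈ G_{r,n} : τ(n−1) = n and z_{n−1} = i}. -/

import Mathlib

open Finset Polynomial

/-- Number of excedances of a permutation: #{i : τ(i) > i}. -/
def exc {n : ℕ} (τ : Equiv.Perm (Fin n)) : ℕ :=
  (Finset.univ.filter fun i => i < τ i).card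

/-- Number of cycles of a permutation, counting fixed points as cycles. -/
def cyc {n : ℕ} (τ : Equiv.Perm (Fin n)) : ℕ :=
  Multiset.card τ.cycleType + (Finset.univ.filter fun i => τ i = i).card

/-- Color sum of a colored permutation. -/
def csum {r n : ℕ} (z : Fin n → Fin r) : ℕ := ∑ i, (z i : ℕ)

/-- #{i : z_i = 0 and τ(i) > i}. -/
def excA {r n : ℕ} (z : Fin n → Fin r) (τ : Equiv.Perm (Fin n)) : ℕ :=
  (Finset.univ.filter fun i => (z i : ℕ) = 0 ∧ i < τ i).card

/-- Excedance number with respect to the absolute order. -/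
def excAbs {r n : ℕ} (z : Fin n → Fin r) (τ : Equiv.Perm (Fin n)) : ℕ :=
  exc τ + csum z

/-- Excedance number with respect to the color order. -/
def excClr {r n : ℕ} (z : Fin n → Fin r) (τ : Equiv.Perm (Fin n)) : ℕ :=
  r * excA z τ + csum z

/-- The permutation of `Fin (n + 1)` that acts as `τ` on `Fin n` and fixes the last element. -/
def extendLast {n : ℕ} (τ : Equiv.Perm (Fin n)) : Equiv.Perm (Fin (n + 1)) :=
  finSuccEquivLast.symm.permCongr τ.optionCongr

@[simp] theorem extendLast_castSucc {n : ℕ} (τ : Equiv.Perm (Fin n)) (j : Fin n) :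
    extendLast τ j.castSucc = (τ j).castSucc := by
  simp [extendLast]

@[simp] theorem extendLast_last {n : ℕ} (τ : Equiv.Perm (Fin n)) :
    extendLast τ (Fin.last n) = Fin.last n := by
  simp [extendLast]

theorem sign_extendLast {n : ℕ} (τ : Equiv.Perm (Fin n)) :
    Equiv.Perm.sign (extendLast τ) = Equiv.Perm.sign τ := by
  rw [extendLast, Equiv.Perm.sign_permCongr, Equiv.optionCongr_sign]

theorem extendLast_injective {n : ℕ} : Function.Injective (extendLast (n := n)) :=
  finSuccEquivLast.symm.permCongr.injective.comp Equiv.optionCongr_injective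

theorem exists_extendLast_eq {n : ℕ} {τ : Equiv.Perm (Fin (n + 1))}
    (h : τ (Fin.last n) = Fin.last n) : ∃ ρ, extendLast ρ = τ := by
  refine ⟨Equiv.removeNone (finSuccEquivLast.permCongr τ), ?_⟩
  have hfix : finSuccEquivLast.permCongr τ none = none := by simp [h]
  rw [extendLast, map_equiv_removeNone, hfix, Equiv.swap_self, ← Equiv.Perm.one_def, one_mul]
  ext j
  simp

theorem neg_one_pow_cyc {n : ℕ} (τ : Equiv.Perm (Fin n)) :
    (-1 : ℤˣ) ^ cyc τ = (-1) ^ n * Equiv.Perm.sign τ := by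
  have hcard : #τ.support + #{i | τ i = i} = n := by
    have h := Finset.card_filter_add_card_filter_not (s := univ) (fun i => τ i ≠ i)
    simpa [Equiv.Perm.support] using h
  rw [Equiv.Perm.sign_of_cycleType, Equiv.Perm.sum_cycleType, cyc, ← pow_add]
  apply neg_one_pow_congr
  grind

/-- Insert a new last element `n + 1` into the cycle of `n`, as the image of `n`. -/
def insertLast {n : ℕ} (τ : Equiv.Perm (Fin (n + 1))) : Equiv.Perm (Fin (n + 2)) :=
  extendLast τ * Equiv.swap (Fin.last n).castSucc (Fin.last (n + 1))

theorem insertLast_castSucc_last {n : ℕ} (τ : Equiv.Perm (Fin (n + 1))) :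
    insertLast τ (Fin.last n).castSucc = Fin.last (n + 1) := by
  simp [insertLast]

theorem insertLast_last {n : ℕ} (τ : Equiv.Perm (Fin (n + 1))) :
    insertLast τ (Fin.last (n + 1)) = (τ (Fin.last n)).castSucc := by
  simp [insertLast]

theorem insertLast_castSucc_castSucc {n : ℕ} (τ : Equiv.Perm (Fin (n + 1))) (j : Fin n) :
    insertLast τ j.castSucc.castSucc = (τ j.castSucc).castSucc := by
  rw [insertLast, Equiv.Perm.mul_apply, Equiv.swap_apply_of_ne_of_ne, extendLast_castSucc]
  · simp
  · exact (Fin.castSucc_lt_last _).ne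

theorem insertLast_injective {n : ℕ} : Function.Injective (insertLast (n := n)) :=
  fun _ _ h => extendLast_injective (mul_right_cancel h)

theorem exists_insertLast_eq {n : ℕ} {τ : Equiv.Perm (Fin (n + 2))}
    (h : τ (Fin.last n).castSucc = Fin.last (n + 1)) : ∃ ρ, insertLast ρ = τ := by
  obtain ⟨ρ, hρ⟩ := exists_extendLast_eq
    (τ := τ * Equiv.swap (Fin.last n).castSucc (Fin.last (n + 1))) (by simpa using h)
  exact ⟨ρ, by rw [insertLast, hρ, mul_assoc, Equiv.swap_mul_self, mul_one]⟩

theorem exc_insertLast {n : ℕ} (τ : Equiv.Perm (Fin (n + 1))) :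
    exc (insertLast τ) = exc τ + 1 := by
  have hlast : ¬ Fin.last n < τ (Fin.last n) := (Fin.le_last _).not_gt
  have hlast' : ¬ Fin.last (n + 1) < (τ (Fin.last n)).castSucc := (Fin.le_last _).not_gt
  simp only [exc, card_filter]
  rw [Fin.sum_univ_castSucc, Fin.sum_univ_castSucc, Fin.sum_univ_castSucc (n := n)]
  simp only [insertLast_castSucc_castSucc, insertLast_castSucc_last, insertLast_last, hlast, hlast',
    Fin.castSucc_lt_castSucc_iff, Fin.castSucc_lt_last, if_true, if_false, add_zero]

theorem neg_one_pow_cyc_insertLast {n : ℕ} (τ : Equiv.Perm (Fin (n + 1))) :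
    (-1 : ℤˣ) ^ cyc (insertLast τ) = (-1) ^ cyc τ := by
  rw [neg_one_pow_cyc, neg_one_pow_cyc, insertLast, Equiv.Perm.sign_mul, sign_extendLast,
    Equiv.Perm.sign_swap (Fin.castSucc_lt_last _).ne]
  simp [pow_succ]

theorem csum_insertNth {r n : ℕ} (p : Fin (n + 1)) (c : Fin r) (z : Fin n → Fin r) :
    csum (p.insertNth c z : Fin (n + 1) → Fin r) = c + csum z := by
  simp [csum, Fin.sum_univ_succAbove _ p]

theorem stmt18 (r n i : ℕ) (hr : 0 < r) (hn : 2 ≤ n) (hi : i < r) :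
    ∑ σ ∈ Finset.univ.filter
        (fun σ : (Fin n → Fin r) × Equiv.Perm (Fin n) =>
          σ.2 ⟨n - 2, by omega⟩ = ⟨n - 1, by omega⟩ ∧ (σ.1 ⟨n - 2, by omega⟩ : ℕ) = i),
      (X : Polynomial ℤ) ^ excAbs σ.1 σ.2 * (-1) ^ cyc σ.2 =
    (X : Polynomial ℤ) ^ (i + 1) *
      ∑ σ : (Fin (n - 1) → Fin r) × Equiv.Perm (Fin (n - 1)),
        (X : Polynomial ℤ) ^ excAbs σ.1 σ.2 * (-1) ^ cyc σ.2 := by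
  obtain ⟨m, rfl⟩ := Nat.exists_eq_add_of_le' hn
  change ∑ σ ∈ Finset.univ.filter
        (fun σ : (Fin (m + 2) → Fin r) × Equiv.Perm (Fin (m + 2)) =>
          σ.2 (Fin.last m).castSucc = Fin.last (m + 1) ∧ (σ.1 (Fin.last m).castSucc : ℕ) = i),
      (X : Polynomial ℤ) ^ excAbs σ.1 σ.2 * (-1) ^ cyc σ.2 =
    (X : Polynomial ℤ) ^ (i + 1) *
      ∑ σ : (Fin (m + 1) → Fin r) × Equiv.Perm (Fin (m + 1)),
        (X : Polynomial ℤ) ^ excAbs σ.1 σ.2 * (-1) ^ cyc σ.2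
  rw [mul_sum]
  symm
  refine sum_bij (fun σ _ => ((Fin.last m).castSucc.insertNth ⟨i, hi⟩ σ.1, insertLast σ.2))
    ?_ ?_ ?_ ?_
  · intro σ _
    simp [insertLast_castSucc_last]
  · rintro ⟨z, τ⟩ _ ⟨z', τ'⟩ _ h
    obtain ⟨hz, hτ⟩ := Prod.ext_iff.mp h
    exact Prod.ext (Fin.insertNth_right_injective (α := fun _ => Fin r) _ hz) (insertLast_injective hτ)
  · rintro ⟨z, τ⟩ h
    obtain ⟨hτ, hz⟩ := (mem_filter.mp h).2
    obtain ⟨ρ, rfl⟩ := exists_insertLast_eq hτ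
    subst hz
    exact ⟨((Fin.last m).castSucc.removeNth z, ρ), mem_univ _, by simp⟩
  · rintro ⟨z, τ⟩ _
    have hsign : (-1 : ℤ[X]) ^ cyc (insertLast τ) = (-1) ^ cyc τ := by
      simpa using congrArg (fun u : ℤˣ => ((u : ℤ) : ℤ[X])) (neg_one_pow_cyc_insertLast τ)
    simp only [excAbs, exc_insertLast, csum_insertNth, hsign]
    ring
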